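/- arXiv:1412.2406 — 4 statements merged into one kernel-verified Lean document; each statement's English description precedes it below -/
import Mathlib

section
/- Let p be a prime number and let x, y be integers with y ≠ 0 and p > 1 + |y|. Then gcd(p·(x+1), p·y) ≥ p, gcd(p·(x+1) − 1, p·y) ≤ |y|, and consequently gcd(p·(x+1), p·y) > 1 + gcd(p·(x+1) − 1, p·y). -/
/-- Let `p` be a prime and `x y : ℤ` with `y ≠ 0` and `p > 1 + |y|`. Then
`gcd (p*(x+1)) (p*y) ≥ p`, `gcd (p*(x+1) - 1) (p*y) ≤ |y|`, and therefore
`gcd (p*(x+1)) (p*y) > 1 + gcd (p*(x+1) - 1) (p*y)`. -/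
theorem turaev_claim_arithmetic (p : ℕ) (hp : p.Prime) (x y : ℤ) (hy : y ≠ 0)
    (hpy : (p : ℤ) > 1 + |y|) :
    (p : ℤ) ≤ (Int.gcd ((p : ℤ) * (x + 1)) ((p : ℤ) * y) : ℤ) ∧
    (Int.gcd ((p : ℤ) * (x + 1) - 1) ((p : ℤ) * y) : ℤ) ≤ |y| ∧
    (Int.gcd ((p : ℤ) * (x + 1)) ((p : ℤ) * y) : ℤ) >
      1 + (Int.gcd ((p : ℤ) * (x + 1) - 1) ((p : ℤ) * y) : ℤ) := by
  have hp0 : (p : ℤ) ≠ 0 := by exact_mod_cast hp.ne_zero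
  have h1 : (p : ℤ) ≤ (Int.gcd ((p : ℤ) * (x + 1)) ((p : ℤ) * y) : ℤ) := by
    apply Int.le_of_dvd
    · have : 0 < Int.gcd ((p : ℤ) * (x + 1)) ((p : ℤ) * y) :=
        Int.gcd_pos_of_ne_zero_right _ (mul_ne_zero hp0 hy)
      exact_mod_cast this
    · exact Int.dvd_coe_gcd (dvd_mul_right _ _) (dvd_mul_right _ _)
  have h2 : (Int.gcd ((p : ℤ) * (x + 1) - 1) ((p : ℤ) * y) : ℤ) ≤ |y| := by
    apply Int.le_of_dvd (abs_pos.mpr hy)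
    rw [dvd_abs]
    have ha := Int.gcd_dvd_left ((p : ℤ) * (x + 1) - 1) ((p : ℤ) * y)
    have hb := Int.gcd_dvd_right ((p : ℤ) * (x + 1) - 1) ((p : ℤ) * y)
    have h := dvd_sub (hb.mul_right (x + 1)) (ha.mul_right y)
    have e : (p : ℤ) * y * (x + 1) - ((p : ℤ) * (x + 1) - 1) * y = y := by ring
    rwa [e] at h
  exact ⟨h1, h2, by linarith⟩
end

section
/- Let φ, ψ ∈ ℤ × ℤ be primitive vectors (i.e., div(φ) = div(ψ) = 1) that are not colinear (i.e., φ₁·ψ₂ − φ₂·ψ₁ ≠ 0). Then there exist vectors α, β ∈ ℤ × ℤ and nonnegative rationals a, b, c, d such that, viewing the vectors inside ℚ × ℚ, α = a·φ + b·ψ and β = c·φ + d·ψ, and moreover div(α) + div(β) < div(α + β). -/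
/-- For primitive, non-colinear vectors `φ ψ : ℤ × ℤ` there exist `α β : ℤ × ℤ`
that are nonnegative rational combinations of `φ` and `ψ` with
`div α + div β < div (α + β)`, where `div v = gcd v.1 v.2`. -/
theorem div_not_superadditive (φ ψ : ℤ × ℤ)
    (hφ : Int.gcd φ.1 φ.2 = 1) (hψ : Int.gcd ψ.1 ψ.2 = 1)
    (hcol : φ.1 * ψ.2 - φ.2 * ψ.1 ≠ 0) :
    ∃ (α β : ℤ × ℤ) (a b c d : ℚ), 0 ≤ a ∧ 0 ≤ b ∧ 0 ≤ c ∧ 0 ≤ d ∧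
      ((α.1 : ℚ) = a * (φ.1 : ℚ) + b * (ψ.1 : ℚ) ∧
        (α.2 : ℚ) = a * (φ.2 : ℚ) + b * (ψ.2 : ℚ)) ∧
      ((β.1 : ℚ) = c * (φ.1 : ℚ) + d * (ψ.1 : ℚ) ∧
        (β.2 : ℚ) = c * (φ.2 : ℚ) + d * (ψ.2 : ℚ)) ∧
      Int.gcd α.1 α.2 + Int.gcd β.1 β.2 < Int.gcd (α.1 + β.1) (α.2 + β.2) := by
  obtain ⟨p, q⟩ := φ
  obtain ⟨x, y⟩ := ψ
  simp only at hφ hψ hcol ⊢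
  obtain ⟨u, v, huv⟩ := Int.isCoprime_iff_gcd_eq_one.mpr hφ
  obtain ⟨s, hs, hsD⟩ : ∃ s : ℤ, s * s = 1 ∧ 0 < s * (p * y - q * x) := by
    rcases lt_or_gt_of_ne hcol with h | h
    · exact ⟨-1, by norm_num, by linarith⟩
    · exact ⟨1, by norm_num, by linarith⟩
  -- the second basis vector, pushed into the cone
  obtain ⟨k, hk⟩ : ∃ k : ℤ, 0 ≤ k * (s * (p * y - q * x)) + (-v * y - u * x) := by
    refine ⟨|(-v * y - u * x)|, ?_⟩
    have h1 := neg_abs_le (-v * y - u * x)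
    have h2 := abs_nonneg (-v * y - u * x)
    nlinarith
  obtain ⟨w, hw⟩ : ∃ w, w = -(s * v) + k * p := ⟨_, rfl⟩
  obtain ⟨z, hz⟩ : ∃ z, z = s * u + k * q := ⟨_, rfl⟩
  have hdet : p * z - q * w = s := by
    subst hw hz; linear_combination s * huv
  have hA : 0 ≤ s * (w * y - z * x) := by
    have : s * (w * y - z * x) = k * (s * (p * y - q * x)) + (-v * y - u * x) := by
      subst hw hz; linear_combination (-v * y - u * x) * hs
    rw [this]; exact hk
  have hD : (0 : ℚ) < s * (p * y - q * x) := by exact_mod_cast hsD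
  have hA' : (0 : ℚ) ≤ s * (w * y - z * x) := by exact_mod_cast hA
  have hdet' : (p * z - q * w : ℚ) = s := by exact_mod_cast hdet
  have hs' : (s * s : ℚ) = 1 := by exact_mod_cast hs
  obtain ⟨E, hE⟩ : ∃ E : ℚ, E = s * (p * y - q * x) := ⟨_, rfl⟩
  rw [← hE] at hD
  obtain ⟨i, hi0, hi⟩ : ∃ i : ℚ, 0 ≤ i ∧ i * E = 1 :=
    ⟨E⁻¹, by positivity, inv_mul_cancel₀ hD.ne'⟩
  rw [hE] at hi
  have hW : (w : ℚ) = (s * (w * y - z * x)) * i * p + i * x := by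
    linear_combination (-w : ℚ) * hi + i * x * (s : ℚ) * hdet' + i * x * hs'
  have hZ : (z : ℚ) = (s * (w * y - z * x)) * i * q + i * y := by
    linear_combination (-z : ℚ) * hi + i * y * (s : ℚ) * hdet' + i * y * hs'
  refine ⟨(p, q), (2 * p + 3 * w, 2 * q + 3 * z), 1, 0,
    2 + 3 * ((s * (w * y - z * x)) * i), 3 * i, by norm_num, le_rfl, by positivity,
    by positivity, by simp, ⟨?_, ?_⟩, ?_⟩
  · push_cast; linear_combination 3 * hW
  · push_cast; linear_combination 3 * hZ
  · have h1 : Int.gcd (2 * p + 3 * w) (2 * q + 3 * z) = 1 :=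
      Int.isCoprime_iff_gcd_eq_one.mp
        ⟨s * (-q - z), s * (p + w), by linear_combination s * hdet + hs⟩
    have h2 : Int.gcd (p + w) (q + z) = 1 :=
      Int.isCoprime_iff_gcd_eq_one.mp ⟨-s * q, s * p, by linear_combination s * hdet + hs⟩
    have h3 : Int.gcd (p + (2 * p + 3 * w)) (q + (2 * q + 3 * z)) = 3 := by
      rw [show p + (2 * p + 3 * w) = 3 * (p + w) by ring,
        show q + (2 * q + 3 * z) = 3 * (q + z) by ring, Int.gcd_mul_left, h2]
      rfl
    simp only [h1, h3, hφ]
    norm_num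
end

section
/- Let R be a principal ideal domain and m a natural number. Suppose f : R^m → P, g : P → M and h : M → F are R-module homomorphisms such that P is a finitely generated free R-module, F is a torsion-free R-module, the image of f equals the kernel of g, and the image of g equals the kernel of h. Then the torsion submodule of M can be generated by at most m elements. -/
/-- Over a PID `R`: given `f : R^m → P`, `g : P → M`, `h : M → F` with `P` finitely
generated free, `F` torsion-free, `range f = ker g` and `range g = ker h`, the torsion
submodule of `M` can be generated by at most `m` elements. -/
theorem torsion_generated_by_m {R : Type*} [CommRing R] [IsDomain R] [IsPrincipalIdealRing R]
    {P M F : Type*} [AddCommGroup P] [Module R P] [AddCommGroup M] [Module R M]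
    [AddCommGroup F] [Module R F]
    [Module.Free R P] [Module.Finite R P]
    (hF : Submodule.torsion R F = ⊥)
    (m : ℕ) (f : (Fin m → R) →ₗ[R] P) (g : P →ₗ[R] M) (h : M →ₗ[R] F)
    (hfg : LinearMap.range f = LinearMap.ker g)
    (hgh : LinearMap.range g = LinearMap.ker h) :
    ∃ T : Finset M, T.card ≤ m ∧
      Submodule.span R (↑T : Set M) = Submodule.torsion R M := by
  classical
  obtain ⟨n, snf⟩ := Submodule.smithNormalForm (Module.Free.chooseBasis R P) (LinearMap.ker g)
  have hn : n ≤ m := by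
    have h1 : Module.finrank R (LinearMap.ker g) = n := by
      rw [Module.finrank_eq_card_basis snf.bN, Fintype.card_fin]
    have h2 := LinearMap.finrank_range_le f
    rw [hfg, h1] at h2
    simpa using h2
  refine ⟨Finset.univ.image (fun i => g (snf.bM (snf.f i))), ?_, ?_⟩
  · exact Finset.card_image_le.trans (by simpa using hn)
  · apply le_antisymm
    · rw [Submodule.span_le]
      intro x hx
      simp only [Finset.coe_image, Finset.coe_univ, Set.image_univ, Set.mem_range] at hx
      obtain ⟨i, rfl⟩ := hx
      have hsn := snf.snf i
      have ha : snf.a i ≠ 0 := by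
        intro h0
        rw [h0, zero_smul] at hsn
        exact snf.bN.ne_zero i (Subtype.ext hsn)
      refine (Submodule.mem_torsion_iff _).2 ⟨⟨snf.a i, mem_nonZeroDivisors_of_ne_zero ha⟩, ?_⟩
      change snf.a i • g (snf.bM (snf.f i)) = 0
      rw [← map_smul, ← hsn]
      exact (snf.bN i).2
    · intro x hx
      obtain ⟨⟨r, hr⟩, hrx⟩ := (Submodule.mem_torsion_iff _).1 hx
      change r • x = 0 at hrx
      have hr0 : r ≠ 0 := nonZeroDivisors.ne_zero hr
      have hhx : h x ∈ Submodule.torsion R F := by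
        refine (Submodule.mem_torsion_iff _).2 ⟨⟨r, hr⟩, ?_⟩
        change r • h x = 0
        rw [← map_smul, hrx, map_zero]
      rw [hF, Submodule.mem_bot] at hhx
      have hxg : x ∈ LinearMap.range g := by
        rw [hgh]; exact hhx
      obtain ⟨p, rfl⟩ := hxg
      have hp : r • p ∈ LinearMap.ker g := by
        rw [LinearMap.mem_ker, map_smul]; exact hrx
      rw [← snf.bM.sum_repr p, map_sum]
      refine Submodule.sum_mem _ fun j _ => ?_
      rw [map_smul]
      by_cases hj : j ∈ Set.range snf.f
      · obtain ⟨i, rfl⟩ := hj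
        exact Submodule.smul_mem _ _ (Submodule.subset_span (by simp))
      · have h0 := snf.repr_eq_zero_of_notMem_range ⟨r • p, hp⟩ hj
        simp only [map_smul, Finsupp.smul_apply, smul_eq_mul, mul_eq_zero, hr0, false_or] at h0
        rw [h0, zero_smul]
        exact Submodule.zero_mem _
end

section
/- Let R be a principal ideal domain, let r ∈ R be a nonzero non-unit, and let n, m be natural numbers. Suppose M is an R-module whose torsion submodule is isomorphic to (R ⧸ (r))^n, and suppose there are R-module homomorphisms f : R^m → P, g : P → M and h : M → F with P a finitely generated free R-module, F a torsion-free R-module, the image of f equal to the kernel of g, and the image of g equal to the kernel of h. Then m ≥ n. -/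
/-- Over a PID `R`, let `r ∈ R` be a nonzero non-unit and suppose the torsion submodule
of `M` is isomorphic to `(R ⧸ (r))^n`. If there are maps `f : R^m → P`, `g : P → M`,
`h : M → F` with `P` finitely generated free, `F` torsion-free, `range f = ker g` and
`range g = ker h`, then `m ≥ n`. -/
theorem m_ge_n_of_torsion_power {R : Type*} [CommRing R] [IsDomain R] [IsPrincipalIdealRing R]
    (r : R) (hr0 : r ≠ 0) (hru : ¬IsUnit r) (n m : ℕ)
    {P M F : Type*} [AddCommGroup P] [Module R P] [AddCommGroup M] [Module R M]
    [AddCommGroup F] [Module R F]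
    [Module.Free R P] [Module.Finite R P]
    (hF : Submodule.torsion R F = ⊥)
    (hM : Nonempty ((↥(Submodule.torsion R M)) ≃ₗ[R] (Fin n → R ⧸ Ideal.span {r})))
    (f : (Fin m → R) →ₗ[R] P) (g : P →ₗ[R] M) (h : M →ₗ[R] F)
    (hfg : LinearMap.range f = LinearMap.ker g)
    (hgh : LinearMap.range g = LinearMap.ker h) :
    n ≤ m := by
  obtain ⟨e⟩ := hM
  let A := R ⧸ Ideal.span {r}
  have hA : Nontrivial A := Ideal.Quotient.nontrivial_iff.mpr
    (by rwa [Ne, Ideal.span_singleton_eq_top])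
  have hrA : ∀ a : A, r • a = 0 := by
    intro a
    obtain ⟨b, rfl⟩ := Ideal.Quotient.mk_surjective a
    rw [← Ideal.Quotient.mkₐ_eq_mk R, ← map_smul, Ideal.Quotient.mkₐ_eq_mk,
      Ideal.Quotient.eq_zero_iff_mem, smul_eq_mul]
    exact Ideal.mul_mem_right _ _ (Ideal.mem_span_singleton_self r)
  let N : Submodule R P := (Submodule.torsion R M).comap g
  have hrN : ∀ x ∈ N, r • x ∈ LinearMap.range f := by
    intro x hx
    rw [hfg, LinearMap.mem_ker, map_smul]
    have h1 : r • (⟨g x, hx⟩ : Submodule.torsion R M) = 0 := by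
      apply e.injective
      rw [map_smul, map_zero]
      funext i
      exact hrA _
    exact congrArg Subtype.val h1
  have htf : Module.IsTorsionFree R P := inferInstance
  let mulr : N →ₗ[R] LinearMap.range f :=
    LinearMap.codRestrict _ (r • N.subtype) (fun x => hrN x.1 x.2)
  have hinj : Function.Injective mulr := by
    intro x y hxy
    have h1 : r • (x : P) = r • (y : P) := congrArg Subtype.val hxy
    exact Subtype.ext (smul_right_injective P hr0 h1)
  have hd : Module.finrank R N ≤ m := by
    calc Module.finrank R N ≤ Module.finrank R (LinearMap.range f) :=
          LinearMap.finrank_le_finrank_of_injective hinj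
      _ ≤ Module.finrank R (Fin m → R) := LinearMap.finrank_range_le f
      _ = m := by simp
  refine le_trans ?_ hd
  let q : N →ₗ[R] (Fin n → A) := e.toLinearMap ∘ₗ
    (g.restrict (p := N) (q := Submodule.torsion R M) (fun x hx => hx))
  have hq : Function.Surjective q := by
    apply e.surjective.comp
    rintro ⟨y, hy⟩
    have hy' : y ∈ LinearMap.range g := by
      rw [hgh, LinearMap.mem_ker]
      have : h y ∈ Submodule.torsion R F := by
        obtain ⟨a, ha⟩ := hy
        exact ⟨a, by rw [Submonoid.smul_def] at ha ⊢; rw [← map_smul, ha, map_zero]⟩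
      rwa [hF, Submodule.mem_bot] at this
    obtain ⟨x, rfl⟩ := hy'
    exact ⟨⟨x, hy⟩, rfl⟩
  let b := Module.finBasis R N
  apply le_of_fin_surjective A (Fintype.linearCombination A (fun i => q (b i)))
  intro y
  obtain ⟨x, rfl⟩ := hq y
  refine ⟨fun i => algebraMap R A (b.repr x i), ?_⟩
  conv_rhs => rw [← b.sum_repr x]
  simp only [Fintype.linearCombination_apply, algebraMap_smul, map_sum, map_smul]
end
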